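/- Let I ⊆ R be a proper homogeneous ideal of height at least 2 containing no nonzero linear forms. Then there exist an integer m ≥ 0 and a chain of homogeneous ideals I = J_0, J_1, …, J_m such that for each k the ideal J_{k+1} is a basic double link of J_k of type (d_k, 1), i.e., J_{k+1} = L_k·J_k + (F_k) with L_k a linear form and F_k ∈ J_k a nonzero homogeneous polynomial of degree d_k with F_k, L_k a regular sequence, such that the degrees are strictly increasing, d_0 < d_1 < … < d_{m−1}, and the final ideal J_m is numerically ACM. -/

import Mathlib

open MvPolynomial

noncomputable section

/-- The polynomial ring `K[x_0, ..., x_n]`. -/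
abbrev PR (K : Type) [Field K] (n : ℕ) := MvPolynomial (Fin (n + 1)) K

/-- An ideal is homogeneous if it contains all homogeneous components of its elements. -/
def IsHomogIdeal {K : Type} [Field K] {n : ℕ} (I : Ideal (PR K n)) : Prop :=
  ∀ F ∈ I, ∀ d : ℕ, homogeneousComponent d F ∈ I

/-- `F, G` is a regular sequence in `R`: `F` is a nonzerodivisor on `R` and `G` is a
nonzerodivisor on `R/(F)`. -/
def IsRegSeq {K : Type} [Field K] {n : ℕ} (F G : PR K n) : Prop :=
  IsSMulRegular (PR K n) F ∧
    IsSMulRegular ((PR K n) ⧸ Ideal.span {F}) (Ideal.Quotient.mk (Ideal.span {F}) G)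

/-- The height of an ideal: the infimum of the heights of the primes containing it. -/
def idealHeight {A : Type} [CommRing A] (I : Ideal A) : ℕ∞ :=
  ⨅ (P : PrimeSpectrum A) (_ : I ≤ P.asIdeal), Order.height P

/-- The Hilbert function of `R/I`: `h_{R/I}(t) = dim_K R_t - dim_K (I ∩ R_t)`. -/
def hilbQuot {K : Type} [Field K] {n : ℕ} (I : Ideal (PR K n)) (t : ℤ) : ℤ :=
  if t < 0 then 0 else
    (Module.finrank K (homogeneousSubmodule (Fin (n + 1)) K t.toNat) : ℤ) -
      (Module.finrank K
        ((Submodule.restrictScalars K I) ⊓ homogeneousSubmodule (Fin (n + 1)) K t.toNat :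
          Submodule K (PR K n)) : ℤ)

/-- The Hilbert function of the polynomial ring in `n+1` variables. -/
def hPoly (n : ℕ) (k : ℤ) : ℤ := if k < 0 then 0 else (Nat.choose (n + k.toNat) n : ℤ)

/-- The ideal `J` has a free resolution `0 → A^p → A^q → J → 0`. -/
def HasLen1FreeRes {A : Type} [CommRing A] (J : Ideal A) : Prop :=
  ∃ (p q : ℕ) (f : (Fin p → A) →ₗ[A] (Fin q → A)) (g : (Fin q → A) →ₗ[A] A),
    Function.Injective f ∧ LinearMap.ker g = LinearMap.range f ∧ LinearMap.range g = J

/-- `J` is numerically ACM: some proper homogeneous ideal `J'` of height 2 with `R/J'`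
Cohen-Macaulay (equivalently, of projective dimension 2) has the same Hilbert function. -/
def NumACM {K : Type} [Field K] {n : ℕ} (J : Ideal (PR K n)) : Prop :=
  ∃ J' : Ideal (PR K n), J' ≠ ⊤ ∧ IsHomogIdeal J' ∧ idealHeight J' = 2 ∧
    HasLen1FreeRes J' ∧ ∀ t : ℤ, hilbQuot J' t = hilbQuot J t

/-- `J` is a basic double link of `I` of type `(d, a)`. -/
def IsBDL {K : Type} [Field K] {n : ℕ} (I J : Ideal (PR K n)) (d a : ℕ) : Prop :=
  ∃ F G : PR K n, F ∈ I ∧ F ≠ 0 ∧ F.IsHomogeneous d ∧ 1 ≤ a ∧ G.IsHomogeneous a ∧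
    IsRegSeq F G ∧ J = Ideal.span {G} * I + Ideal.span {F}

/-- The first map `R → R ⊕ I`, `x ↦ (G·x, -F·x)`. -/
def bdlα {K : Type} [Field K] {n : ℕ} (I : Ideal (PR K n)) (F G : PR K n) (hF : F ∈ I) :
    PR K n →ₗ[PR K n] (PR K n) × I :=
  (LinearMap.mulLeft (PR K n) G).prod
    (LinearMap.codRestrict I (LinearMap.mulLeft (PR K n) (-F))
      (fun x => I.mul_mem_right x (I.neg_mem hF)))

/-- The second map `R ⊕ I → R`, `(p, q) ↦ p·F + q·G`. -/
def bdlβ {K : Type} [Field K] {n : ℕ} (I : Ideal (PR K n)) (F G : PR K n) :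
    (PR K n) × I →ₗ[PR K n] PR K n :=
  (LinearMap.mulLeft (PR K n) F).comp (LinearMap.fst _ _ _) +
    (LinearMap.mulLeft (PR K n) G).comp (I.subtype.comp (LinearMap.snd _ _ _))
/-- The finite difference operator `(Δf)(k) = f(k) - f(k-1)`. -/
def deltaOp (f : ℤ → ℤ) : ℤ → ℤ := fun k => f k - f (k - 1)

/-- The number of minimal generators of `I` in degree `d`, i.e. the `K`-dimension of the
degree-`d` component of `I/𝔪I`, computed as `dim_K (I ∩ R_d) - dim_K (𝔪I ∩ R_d)`. -/
def minGensDeg {K : Type} [Field K] {n : ℕ} (I : Ideal (PR K n)) (d : ℕ) : ℤ :=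
  (Module.finrank K
      ((Submodule.restrictScalars K I) ⊓ homogeneousSubmodule (Fin (n + 1)) K d :
        Submodule K (PR K n)) : ℤ) -
    (Module.finrank K
      ((Submodule.restrictScalars K
          (Ideal.span (Set.range (X : Fin (n + 1) → PR K n)) * I)) ⊓
          homogeneousSubmodule (Fin (n + 1)) K d :
        Submodule K (PR K n)) : ℤ)

/-- The ideal `I` is saturated with respect to `𝔪 = (x_0, ..., x_n)`. -/
def IsSatIdeal {K : Type} [Field K] {n : ℕ} (I : Ideal (PR K n)) : Prop :=
  ∀ x : PR K n,
    (∃ k : ℕ, ∀ y ∈ (Ideal.span (Set.range (X : Fin (n + 1) → PR K n))) ^ k, x * y ∈ I) →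
      x ∈ I

section HilbertSeries

variable {K : Type} [Field K] {n : ℕ}

/-- The degree `t` part of an ideal. -/
def degPart (I : Ideal (PR K n)) (t : ℕ) : Submodule K (PR K n) :=
  Submodule.restrictScalars K I ⊓ homogeneousSubmodule (Fin (n + 1)) K t

/-- The Hilbert series of an ideal. -/
def hilbSeries (I : Ideal (PR K n)) : PowerSeries ℤ :=
  PowerSeries.mk fun t => (Module.finrank K (degPart I t) : ℤ)

/-- The ideal quotient `I : G`. -/
def colonBy (I : Ideal (PR K n)) (G : PR K n) : Ideal (PR K n) :=
  Submodule.comap (LinearMap.mulLeft (PR K n) G) I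

lemma mem_colonBy {I : Ideal (PR K n)} {G x : PR K n} : x ∈ colonBy I G ↔ G * x ∈ I := Iff.rfl

lemma mem_degPart {I : Ideal (PR K n)} {t : ℕ} {x : PR K n} :
    x ∈ degPart I t ↔ x ∈ I ∧ x.IsHomogeneous t := by
  simp [degPart, Submodule.mem_inf, mem_homogeneousSubmodule]

instance finite_homogeneousSubmodule (t : ℕ) :
    FiniteDimensional K (homogeneousSubmodule (Fin (n + 1)) K t) := by
  have h : homogeneousSubmodule (Fin (n + 1)) K t ≤ restrictTotalDegree (Fin (n + 1)) K t := by
    intro p hp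
    rw [mem_restrictTotalDegree]
    exact (mem_homogeneousSubmodule _ _ |>.1 hp).totalDegree_le
  exact Submodule.finiteDimensional_of_le h

instance finite_degPart (I : Ideal (PR K n)) (t : ℕ) : FiniteDimensional K (degPart I t) :=
  Submodule.finiteDimensional_of_le
    (inf_le_right : _ ≤ homogeneousSubmodule (Fin (n + 1)) K t)

lemma homogeneousComponent_mul_of_le {G : PR K n} {a : ℕ} (hG : G.IsHomogeneous a)
    (x : PR K n) {t : ℕ} (h : a ≤ t) :
    homogeneousComponent t (G * x) = G * homogeneousComponent (t - a) x := by
  let := gradedAlgebra (σ := Fin (n + 1)) (R := K)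
  have hG' : G ∈ homogeneousSubmodule (Fin (n + 1)) K a := hG
  have := DirectSum.coe_decompose_mul_of_left_mem_of_le (homogeneousSubmodule (Fin (n + 1)) K)
    (b := x) hG' h
  simpa [← decomposition.decompose'_apply] using! this

lemma homogeneousComponent_mul_of_lt {G : PR K n} {a : ℕ} (hG : G.IsHomogeneous a)
    (x : PR K n) {t : ℕ} (h : t < a) : homogeneousComponent t (G * x) = 0 := by
  let := gradedAlgebra (σ := Fin (n + 1)) (R := K)
  have hG' : G ∈ homogeneousSubmodule (Fin (n + 1)) K a := hG
  have := DirectSum.coe_decompose_mul_of_left_mem_of_not_le (homogeneousSubmodule (Fin (n + 1)) K)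
    (b := x) hG' (not_le.2 h)
  simpa [← decomposition.decompose'_apply] using! this

lemma IsHomogIdeal.colon {I : Ideal (PR K n)} (hI : IsHomogIdeal I) {G : PR K n} {a : ℕ}
    (hG : G.IsHomogeneous a) : IsHomogIdeal (colonBy I G) := by
  intro x hx d
  have := hI _ hx (d + a)
  rw [LinearMap.mulLeft_apply, homogeneousComponent_mul_of_le hG _ (by omega)] at this
  rw [Nat.add_sub_cancel] at this
  exact this

lemma IsHomogIdeal.span_singleton_mul {I : Ideal (PR K n)} (hI : IsHomogIdeal I) {G : PR K n}
    {a : ℕ} (hG : G.IsHomogeneous a) : IsHomogIdeal (Ideal.span {G} * I) := by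
  intro x hx d
  obtain ⟨y, hy, rfl⟩ := Ideal.mem_span_singleton_mul.1 hx
  rcases le_or_gt a d with h | h
  · rw [homogeneousComponent_mul_of_le hG _ h]
    exact Ideal.mem_span_singleton_mul.2 ⟨_, hI _ hy _, rfl⟩
  · rw [homogeneousComponent_mul_of_lt hG _ h]
    exact zero_mem _

lemma isHomogIdeal_top : IsHomogIdeal (⊤ : Ideal (PR K n)) := fun _ _ _ => trivial

lemma IsHomogIdeal.sup {I J : Ideal (PR K n)} (hI : IsHomogIdeal I) (hJ : IsHomogIdeal J) :
    IsHomogIdeal (I ⊔ J) := by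
  intro x hx d
  obtain ⟨y, hy, z, hz, rfl⟩ := Submodule.mem_sup.1 hx
  rw [map_add]
  exact Submodule.add_mem_sup (hI _ hy d) (hJ _ hz d)

lemma isHomogIdeal_span_singleton {G : PR K n} {a : ℕ} (hG : G.IsHomogeneous a) :
    IsHomogIdeal (Ideal.span {G}) := by
  simpa using isHomogIdeal_top.span_singleton_mul hG

lemma degPart_span_singleton_mul (I : Ideal (PR K n)) {G : PR K n} (hG0 : G ≠ 0) {a : ℕ}
    (hG : G.IsHomogeneous a) (s : ℕ) :
    degPart (Ideal.span {G} * I) (s + a) = (degPart I s).map (LinearMap.mulLeft K G) := by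
  ext x
  simp only [mem_degPart, Submodule.mem_map, LinearMap.mulLeft_apply, Ideal.mem_span_singleton_mul]
  constructor
  · rintro ⟨⟨y, hy, rfl⟩, hx⟩
    refine ⟨y, ⟨hy, ?_⟩, rfl⟩
    have h := homogeneousComponent_mul_of_le hG y (Nat.le_add_left a s)
    rw [homogeneousComponent_eq_self hx, Nat.add_sub_cancel] at h
    rw [mul_left_cancel₀ hG0 h]
    exact homogeneousComponent_isHomogeneous _ _
  · rintro ⟨y, ⟨hy, hy'⟩, rfl⟩
    exact ⟨⟨y, hy, rfl⟩, add_comm a s ▸ hG.mul hy'⟩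

lemma degPart_span_singleton_mul_of_lt (I : Ideal (PR K n)) {G : PR K n} {a : ℕ}
    (hG : G.IsHomogeneous a) {t : ℕ} (h : t < a) : degPart (Ideal.span {G} * I) t = ⊥ := by
  rw [eq_bot_iff]
  intro x hx
  obtain ⟨hx, hx'⟩ := mem_degPart.1 hx
  obtain ⟨y, hy, rfl⟩ := Ideal.mem_span_singleton_mul.1 hx
  rw [← homogeneousComponent_eq_self hx', homogeneousComponent_mul_of_lt hG _ h]
  exact zero_mem _

lemma finrank_map_mulLeft {G : PR K n} (hG0 : G ≠ 0) (V : Submodule K (PR K n)) :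
    Module.finrank K (V.map (LinearMap.mulLeft K G)) = Module.finrank K V :=
  (Submodule.equivMapOfInjective (LinearMap.mulLeft K G) (mul_right_injective₀ hG0) V).finrank_eq.symm

lemma hilbSeries_span_singleton_mul (I : Ideal (PR K n)) {G : PR K n} (hG0 : G ≠ 0) {a : ℕ}
    (hG : G.IsHomogeneous a) :
    hilbSeries (Ideal.span {G} * I) = PowerSeries.X ^ a * hilbSeries I := by
  ext t
  rw [PowerSeries.coeff_X_pow_mul']
  simp only [hilbSeries, PowerSeries.coeff_mk]
  split_ifs with h
  · obtain ⟨s, rfl⟩ := Nat.exists_eq_add_of_le' h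
    rw [degPart_span_singleton_mul I hG0 hG, finrank_map_mulLeft hG0, Nat.add_sub_cancel]
  · rw [degPart_span_singleton_mul_of_lt I hG (not_le.1 h)]
    simp

lemma degPart_sup {I J : Ideal (PR K n)} (hI : IsHomogIdeal I) (hJ : IsHomogIdeal J) (t : ℕ) :
    degPart (I ⊔ J) t = degPart I t ⊔ degPart J t := by
  apply le_antisymm
  · intro x hx
    obtain ⟨hx, hx'⟩ := mem_degPart.1 hx
    obtain ⟨y, hy, z, hz, rfl⟩ := Submodule.mem_sup.1 hx
    rw [← homogeneousComponent_eq_self hx', map_add]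
    exact Submodule.add_mem_sup
      (mem_degPart.2 ⟨hI _ hy t, homogeneousComponent_isHomogeneous _ _⟩)
      (mem_degPart.2 ⟨hJ _ hz t, homogeneousComponent_isHomogeneous _ _⟩)
  · refine sup_le (fun x hx => ?_) (fun x hx => ?_)
    · obtain ⟨hx, hx'⟩ := mem_degPart.1 hx
      exact mem_degPart.2 ⟨Ideal.mem_sup_left hx, hx'⟩
    · obtain ⟨hx, hx'⟩ := mem_degPart.1 hx
      exact mem_degPart.2 ⟨Ideal.mem_sup_right hx, hx'⟩

lemma inf_span_singleton (I : Ideal (PR K n)) (G : PR K n) :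
    I ⊓ Ideal.span {G} = Ideal.span {G} * colonBy I G := by
  ext x
  simp only [Submodule.mem_inf, Ideal.mem_span_singleton_mul, Ideal.mem_span_singleton, mem_colonBy]
  constructor
  · rintro ⟨hx, y, rfl⟩
    exact ⟨y, hx, rfl⟩
  · rintro ⟨y, hy, rfl⟩
    exact ⟨hy, dvd_mul_right _ _⟩

lemma hilbSeries_sup_add_inf {I J : Ideal (PR K n)} (hI : IsHomogIdeal I) (hJ : IsHomogIdeal J) :
    hilbSeries (I ⊔ J) + hilbSeries (I ⊓ J) = hilbSeries I + hilbSeries J := by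
  ext t
  simp only [hilbSeries, map_add, PowerSeries.coeff_mk]
  have h : degPart (I ⊓ J) t = degPart I t ⊓ degPart J t := by
    ext x
    simp only [Submodule.mem_inf, mem_degPart]
    tauto
  rw [degPart_sup hI hJ, h]
  exact_mod_cast Submodule.finrank_sup_add_finrank_inf_eq _ _

lemma hilbSeries_sup_span_singleton {I : Ideal (PR K n)} (hI : IsHomogIdeal I) {G : PR K n}
    (hG0 : G ≠ 0) {a : ℕ} (hG : G.IsHomogeneous a) :
    hilbSeries (I ⊔ Ideal.span {G}) + PowerSeries.X ^ a * hilbSeries (colonBy I G) =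
      hilbSeries I + PowerSeries.X ^ a * hilbSeries (⊤ : Ideal (PR K n)) := by
  rw [← hilbSeries_span_singleton_mul _ hG0 hG, ← hilbSeries_span_singleton_mul _ hG0 hG,
    ← inf_span_singleton, hilbSeries_sup_add_inf hI (isHomogIdeal_span_singleton hG), Ideal.mul_top]

lemma hilbSeries_basicDoubleLink {I : Ideal (PR K n)} (hI : IsHomogIdeal I) {F G : PR K n}
    (hF0 : F ≠ 0) (hG0 : G ≠ 0) {a d : ℕ} (hF : F.IsHomogeneous d) (hG : G.IsHomogeneous a)
    (hFI : F ∈ I) (hFG : IsRelPrime F G) :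
    hilbSeries (Ideal.span {G} * I ⊔ Ideal.span {F}) =
      PowerSeries.X ^ a * hilbSeries I +
        PowerSeries.X ^ d * (1 - PowerSeries.X ^ a) * hilbSeries (⊤ : Ideal (PR K n)) := by
  have h1 := hilbSeries_sup_span_singleton (hI.span_singleton_mul hG) hF0 hF
  have h2 : colonBy (Ideal.span {G} * I) F = Ideal.span {G} * ⊤ := by
    ext x
    rw [mem_colonBy, Ideal.mul_top, Ideal.mem_span_singleton, Ideal.mem_span_singleton_mul]
    constructor
    · rintro ⟨y, -, h⟩
      exact hFG.symm.dvd_of_dvd_mul_left ⟨y, h.symm⟩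
    · rintro ⟨y, rfl⟩
      exact ⟨F * y, I.mul_mem_right _ hFI, by ring⟩
  rw [h2, hilbSeries_span_singleton_mul _ hG0 hG, hilbSeries_span_singleton_mul _ hG0 hG] at h1
  linear_combination h1

end HilbertSeries

section HilbertSerre

variable {K : Type} [Field K] {n : ℕ}

/-- The Hilbert series of `R/I`. -/
def quotSeries (I : Ideal (PR K n)) : PowerSeries ℤ :=
  hilbSeries (⊤ : Ideal (PR K n)) - hilbSeries I

lemma quotSeries_sup_span_singleton {I : Ideal (PR K n)} (hI : IsHomogIdeal I) {G : PR K n}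
    (hG0 : G ≠ 0) {a : ℕ} (hG : G.IsHomogeneous a) :
    quotSeries I =
      quotSeries (I ⊔ Ideal.span {G}) + PowerSeries.X ^ a * quotSeries (colonBy I G) := by
  simp only [quotSeries]
  linear_combination hilbSeries_sup_span_singleton hI hG0 hG

lemma quotSeries_anti {I J : Ideal (PR K n)} (h : I ≤ J) (t : ℕ) :
    PowerSeries.coeff t (quotSeries J) ≤ PowerSeries.coeff t (quotSeries I) := by
  have : Module.finrank K (degPart I t) ≤ Module.finrank K (degPart J t) :=
    Submodule.finrank_mono (inf_le_inf_right _ h)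
  simp only [quotSeries, hilbSeries, map_sub, PowerSeries.coeff_mk]
  omega

lemma quotSeries_top : quotSeries (⊤ : Ideal (PR K n)) = 0 := sub_self _

lemma coeff_quotSeries_nonneg (I : Ideal (PR K n)) (t : ℕ) :
    0 ≤ PowerSeries.coeff t (quotSeries I) := by
  simpa [quotSeries_top] using quotSeries_anti (le_top : I ≤ ⊤) t

lemma degPart_eq_of_forall_X_mem {I : Ideal (PR K n)} (hX : ∀ i, X i ∈ I) {t : ℕ} (ht : t ≠ 0) :
    degPart I t = degPart ⊤ t := by
  refine le_antisymm (inf_le_inf_right _ le_top) fun x hx => ?_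
  obtain ⟨-, hx⟩ := mem_degPart.1 hx
  refine mem_degPart.2 ⟨?_, hx⟩
  rw [x.as_sum]
  refine I.sum_mem fun m hm => ?_
  have hm' : m.degree = t := by
    rw [Finsupp.degree_eq_weight_one]
    exact hx (mem_support_iff.1 hm)
  obtain ⟨i, hi⟩ : ∃ i, m i ≠ 0 := by
    by_contra! h
    have : m = 0 := Finsupp.ext h
    subst this
    simp at hm'
    exact ht hm'.symm
  exact I.mem_of_dvd (X_dvd_monomial.2 (Or.inr hi)) (hX i)

lemma quotSeries_of_forall_X_mem {I : Ideal (PR K n)} (hX : ∀ i, X i ∈ I) :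
    quotSeries I = PowerSeries.C (PowerSeries.coeff 0 (quotSeries I)) := by
  ext t
  rw [PowerSeries.coeff_C]
  split_ifs with h
  · rw [h]
  · rw [quotSeries, map_sub, hilbSeries, hilbSeries, PowerSeries.coeff_mk, PowerSeries.coeff_mk,
      degPart_eq_of_forall_X_mem hX h, sub_self]

lemma colonBy_colonBy (I : Ideal (PR K n)) (G H : PR K n) :
    colonBy (colonBy I G) H = colonBy I (G * H) := by
  ext x
  simp only [mem_colonBy, mul_assoc]

/-- The Hilbert–Serre theorem for cyclic modules. -/
lemma exists_polynomial_quotSeries (j : ℕ) : ∀ I : Ideal (PR K n), IsHomogIdeal I →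
    (∀ i : Fin (n + 1), j ≤ i → X i ∈ I) →
    ∃ p : Polynomial ℤ, (1 - PowerSeries.X) ^ j * quotSeries I = (p : PowerSeries ℤ) := by
  induction j with
  | zero =>
    intro I _ hX
    refine ⟨Polynomial.C (PowerSeries.coeff 0 (quotSeries I)), ?_⟩
    rw [pow_zero, one_mul, Polynomial.coe_C]
    exact quotSeries_of_forall_X_mem fun i => hX i (Nat.zero_le _)
  | succ j ih =>
    by_cases hj : n + 1 ≤ j
    · intro I hI hX
      obtain ⟨p, hp⟩ := ih I hI fun i hi => absurd i.2 (by omega)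
      refine ⟨(1 - Polynomial.X) * p, ?_⟩
      rw [pow_succ', mul_assoc, hp]
      simp
    set x : PR K n := X ⟨j, not_le.1 hj⟩ with hx
    have hx0 : x ≠ 0 := X_ne_zero _
    have hxh : x.IsHomogeneous 1 := isHomogeneous_X _ _
    have hsup : ∀ I : Ideal (PR K n), (∀ i : Fin (n + 1), j + 1 ≤ i → X i ∈ I) →
        ∀ i : Fin (n + 1), j ≤ i → X i ∈ I ⊔ Ideal.span {x} := by
      intro I hX i hi
      rcases Nat.lt_or_ge j i with h | h
      · exact Ideal.mem_sup_left (hX i h)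
      · have : i = ⟨j, not_le.1 hj⟩ := Fin.ext (le_antisymm h hi)
        rw [this]
        exact Ideal.mem_sup_right (Ideal.mem_span_singleton_self _)
    have key : ∀ N : ℕ, ∀ I : Ideal (PR K n), IsHomogIdeal I →
        (∀ i : Fin (n + 1), j + 1 ≤ i → X i ∈ I) → colonBy I (x ^ N) = colonBy I (x ^ (N + 1)) →
        ∃ p : Polynomial ℤ,
          (1 - PowerSeries.X) ^ (j + 1) * quotSeries I = (p : PowerSeries ℤ) := by
      intro N
      induction N with
      | zero =>
        intro I hI hX hN
        obtain ⟨p, hp⟩ := ih (I ⊔ Ideal.span {x}) 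
          (hI.sup (isHomogIdeal_span_singleton hxh)) (hsup I hX)
        refine ⟨p, ?_⟩
        have h := quotSeries_sup_span_singleton hI hx0 hxh
        have h0 : colonBy I x = I := by
          rw [zero_add, pow_one, pow_zero] at hN
          rw [← hN]
          ext y
          rw [mem_colonBy, one_mul]
        rw [h0] at h
        rw [← hp]
        linear_combination (1 - PowerSeries.X) ^ j * h
      | succ N ihN =>
        intro I hI hX hN
        obtain ⟨p, hp⟩ := ih (I ⊔ Ideal.span {x}) 
          (hI.sup (isHomogIdeal_span_singleton hxh)) (hsup I hX)
        obtain ⟨q, hq⟩ := ihN (colonBy I x) (hI.colon hxh)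
          (fun i hi => mem_colonBy.2 (I.mul_mem_left _ (hX i hi)))
          (by rw [colonBy_colonBy, colonBy_colonBy, ← pow_succ', ← pow_succ', hN])
        refine ⟨(1 - Polynomial.X) * p + Polynomial.X * q, ?_⟩
        have h := quotSeries_sup_span_singleton hI hx0 hxh
        simp only [Polynomial.coe_add, Polynomial.coe_mul, Polynomial.coe_sub, Polynomial.coe_one,
          Polynomial.coe_X, ← hp, ← hq]
        linear_combination (1 - PowerSeries.X) ^ (j + 1) * h
    intro I hI hX
    have hmono : Monotone fun N => colonBy I (x ^ N) := by
      refine monotone_nat_of_le_succ fun N y hy => ?_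
      rw [mem_colonBy] at hy ⊢
      rw [pow_succ', mul_assoc]
      exact I.mul_mem_left _ hy
    obtain ⟨N, hN⟩ := monotone_stabilizes_iff_noetherian.2
      (inferInstance : IsNoetherian (PR K n) (PR K n)) ⟨_, hmono⟩
    exact key N I hI hX (hN (N + 1) (Nat.le_succ N))

lemma coeff_zero_hilbSeries_top :
    PowerSeries.coeff 0 (hilbSeries (⊤ : Ideal (PR K n))) = 1 := by
  have h : degPart (⊤ : Ideal (PR K n)) 0 = K ∙ (1 : PR K n) := by
    ext x
    rw [mem_degPart, Submodule.mem_span_singleton]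
    constructor
    · rintro ⟨-, h⟩
      refine ⟨coeff 0 x, ?_⟩
      rw [← homogeneousComponent_eq_self h, homogeneousComponent_zero]
      simp [smul_eq_C_mul]
    · rintro ⟨c, rfl⟩
      refine ⟨trivial, ?_⟩
      rw [smul_eq_C_mul, mul_one]
      exact isHomogeneous_C _ _
  rw [hilbSeries, PowerSeries.coeff_mk, h, finrank_span_singleton one_ne_zero]
  rfl

lemma one_sub_X_pow_mul_quotSeries_span_X (j : ℕ) (hj : j ≤ n + 1) :
    (1 - PowerSeries.X) ^ j *
      quotSeries (Ideal.span (X '' {i : Fin (n + 1) | j ≤ i}) : Ideal (PR K n)) = 1 := by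
  have hhom : ∀ j : ℕ, IsHomogIdeal (Ideal.span (X '' {i : Fin (n + 1) | j ≤ i}) :
      Ideal (PR K n)) := by
    intro j F hF d
    rw [mem_ideal_span_X_image] at hF ⊢
    intro m hm
    refine hF m ?_
    rw [mem_support_iff, coeff_homogeneousComponent] at hm
    rw [mem_support_iff]
    split_ifs at hm <;> simp_all
  induction j with
  | zero =>
    have hX (i) : (X i : PR K n) ∈ Ideal.span (X '' {i : Fin (n + 1) | 0 ≤ (i : ℕ)}) :=
      Ideal.subset_span (Set.mem_image_of_mem _ (Nat.zero_le _))
    rw [quotSeries_of_forall_X_mem hX]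
    have h : degPart (Ideal.span (X '' {i : Fin (n + 1) | 0 ≤ (i : ℕ)}) : Ideal (PR K n)) 0 = ⊥ := by
      rw [eq_bot_iff]
      intro x hx
      obtain ⟨hx, hx'⟩ := mem_degPart.1 hx
      rw [Submodule.mem_bot]
      by_contra hx0
      rw [← homogeneousComponent_eq_self hx', homogeneousComponent_zero] at hx hx0
      rw [mem_ideal_span_X_image] at hx
      obtain ⟨i, -, hi⟩ := hx 0 (by
        rw [mem_support_iff, coeff_zero_C]
        simpa using hx0)
      exact hi rfl
    have h1 := coeff_zero_hilbSeries_top (K := K) (n := n)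
    rw [quotSeries, map_sub, h1, hilbSeries, PowerSeries.coeff_mk, h]
    simp
  | succ j ih =>
    replace ih := ih (by omega)
    set I : Ideal (PR K n) := Ideal.span (X '' {i : Fin (n + 1) | j + 1 ≤ i})
    obtain ⟨x, hx⟩ : ∃ x : PR K n, x = X ⟨j, hj⟩ := ⟨_, rfl⟩
    have hx0 : x ≠ 0 := hx ▸ X_ne_zero _
    have hxh : x.IsHomogeneous 1 := hx ▸ isHomogeneous_X _ _
    have h := quotSeries_sup_span_singleton (hhom (j + 1)) hx0 hxh
    have h1 : I ⊔ Ideal.span {x} = Ideal.span (X '' {i : Fin (n + 1) | j ≤ i}) := by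
      rw [hx, ← Ideal.span_union, ← Set.image_singleton, ← Set.image_union]
      congr 2
      ext i
      simp only [Set.mem_union, Set.mem_ofPred_eq, Set.mem_singleton_iff, Fin.ext_iff]
      omega
    have h2 : colonBy I x = I := by
      ext y
      rw [mem_colonBy]
      refine ⟨fun hy => ?_, fun hy => I.mul_mem_left _ hy⟩
      rw [mem_ideal_span_X_image] at hy ⊢
      intro m hm
      obtain ⟨i, hi, hi'⟩ := hy (m + Finsupp.single ⟨j, hj⟩ 1) (by
        rw [mem_support_iff, hx, mul_comm, coeff_mul_X]
        exact mem_support_iff.1 hm)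
      refine ⟨i, hi, ?_⟩
      have : (⟨j, hj⟩ : Fin (n + 1)) ≠ i := by
        rintro rfl
        simp at hi
      simpa [Finsupp.single_apply, this] using hi'
    rw [h1, h2] at h
    linear_combination (1 - PowerSeries.X) ^ j * h + ih

lemma one_sub_X_pow_mul_hilbSeries_top :
    (1 - PowerSeries.X) ^ (n + 1) * hilbSeries (⊤ : Ideal (PR K n)) = 1 := by
  have h := one_sub_X_pow_mul_quotSeries_span_X (K := K) (n + 1) le_rfl
  have h1 : {i : Fin (n + 1) | n + 1 ≤ (i : ℕ)} = ∅ := by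
    ext i
    simpa using i.is_le
  have h2 : hilbSeries (⊥ : Ideal (PR K n)) = 0 := by
    ext t
    have : degPart (⊥ : Ideal (PR K n)) t = ⊥ := by
      rw [eq_bot_iff]
      exact fun x hx => (mem_degPart.1 hx).1
    simp [hilbSeries, this]
  rwa [h1, Set.image_empty, Ideal.span_empty, quotSeries, h2, sub_zero] at h

end HilbertSerre

section Growth

lemma one_sub_X_mul_mk_one : (1 - PowerSeries.X) * (PowerSeries.mk 1 : PowerSeries ℤ) = 1 := by
  rw [mul_comm]
  exact PowerSeries.mk_one_mul_one_sub_eq_one ℤ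

lemma coeff_mk_one_pow (l t : ℕ) :
    PowerSeries.coeff t ((PowerSeries.mk 1 : PowerSeries ℤ) ^ (l + 1)) =
      ((l + t).choose l : ℤ) := by
  rw [PowerSeries.mk_one_pow_eq_mk_choose_add, PowerSeries.coeff_mk]

lemma exists_bound_coeff_mul_mk_one_pow (q : Polynomial ℤ) (l : ℕ) :
    ∃ M : ℤ, ∀ t, |PowerSeries.coeff t ((q : PowerSeries ℤ) * PowerSeries.mk 1 ^ (l + 1))| ≤
      M * ((l + t).choose l : ℤ) := by
  induction q using Polynomial.induction_on' with
  | add p q hp hq =>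
    obtain ⟨M, hM⟩ := hp
    obtain ⟨N, hN⟩ := hq
    refine ⟨M + N, fun t => ?_⟩
    rw [Polynomial.coe_add, add_mul, map_add, add_mul]
    exact (abs_add_le _ _).trans (add_le_add (hM t) (hN t))
  | monomial k a =>
    refine ⟨|a|, fun t => ?_⟩
    rw [← Polynomial.C_mul_X_pow_eq_monomial, Polynomial.coe_mul, Polynomial.coe_C,
      Polynomial.coe_pow, Polynomial.coe_X, mul_assoc, PowerSeries.coeff_C_mul,
      PowerSeries.coeff_X_pow_mul', abs_mul]
    refine mul_le_mul_of_nonneg_left ?_ (abs_nonneg a)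
    split_ifs with h
    · rw [coeff_mk_one_pow, Nat.abs_cast]
      exact_mod_cast Nat.choose_le_choose l (by omega)
    · rw [abs_zero]
      positivity

lemma exists_eq_one_sub_X_mul {p : Polynomial ℤ} {l : ℕ} {M : ℤ}
    (hM : ∀ t, |PowerSeries.coeff t ((p : PowerSeries ℤ) * PowerSeries.mk 1 ^ (l + 2))| ≤
      M * ((l + t).choose l : ℤ)) :
    ∃ q : Polynomial ℤ, p = (1 - Polynomial.X) * q := by
  obtain ⟨q, hq⟩ : Polynomial.X - Polynomial.C 1 ∣ p - Polynomial.C (p.eval 1) :=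
    Polynomial.X_sub_C_dvd_sub_C_eval
  rw [Polynomial.C_1] at hq
  set c := p.eval 1 with hc
  have hp : p = Polynomial.C c + (1 - Polynomial.X) * (-q) := by linear_combination hq
  suffices h0 : c = 0 by
    refine ⟨-q, ?_⟩
    rw [hp, h0]
    simp
  obtain ⟨N, hN⟩ := exists_bound_coeff_mul_mk_one_pow (-q) l
  have hps : (p : PowerSeries ℤ) * PowerSeries.mk 1 ^ (l + 2) =
      PowerSeries.C c * PowerSeries.mk 1 ^ (l + 1 + 1) +
        ((-q : Polynomial ℤ) : PowerSeries ℤ) * PowerSeries.mk 1 ^ (l + 1) := by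
    conv_lhs => rw [hp]
    rw [Polynomial.coe_add, Polynomial.coe_mul, Polynomial.coe_sub, Polynomial.coe_C,
      Polynomial.coe_one, Polynomial.coe_X]
    linear_combination ((-q : Polynomial ℤ) : PowerSeries ℤ) * PowerSeries.mk 1 ^ (l + 1) *
      one_sub_X_mul_mk_one
  have hbound (t : ℕ) : |c| * (l + 1 + t) ≤ (M + N) * (l + 1) := by
    have h1 := hM t
    rw [hps, map_add, PowerSeries.coeff_C_mul, coeff_mk_one_pow] at h1
    have h2 := hN t
    have h3 : |c * ((l + 1 + t).choose (l + 1) : ℤ)| ≤ (M + N) * ((l + t).choose l : ℤ) := by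
      have := abs_sub_abs_le_abs_sub (c * ((l + 1 + t).choose (l + 1) : ℤ))
        (-(PowerSeries.coeff t (((-q : Polynomial ℤ) : PowerSeries ℤ) *
          PowerSeries.mk 1 ^ (l + 1))))
      rw [abs_neg, sub_neg_eq_add] at this
      linarith
    rw [abs_mul, Nat.abs_cast] at h3
    have h4 : ((l + t + 1 : ℕ) : ℤ) * ((l + t).choose l : ℤ) =
        ((l + 1 + t).choose (l + 1) : ℤ) * ((l + 1 : ℕ) : ℤ) := by
      have := Nat.add_one_mul_choose_eq (l + t) l
      rw [show l + 1 + t = l + t + 1 by omega]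
      exact_mod_cast this
    have h5 : (0 : ℤ) < ((l + t).choose l : ℤ) := by
      exact_mod_cast Nat.choose_pos (Nat.le_add_right l t)
    refine le_of_mul_le_mul_right ?_ h5
    push_cast at h4
    have h6 := mul_le_mul_of_nonneg_right h3 (by positivity : (0 : ℤ) ≤ (l : ℤ) + 1)
    linear_combination h6 + |c| * h4
  by_contra hc0
  have h1 : 1 ≤ |c| := Int.one_le_abs hc0
  have h2 := hbound ((M + N) * (l + 1)).toNat
  have h3 := Int.self_le_toNat ((M + N) * (l + 1))
  nlinarith

end Growth

section HVector

variable {K : Type} [Field K] {n : ℕ}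

lemma hilbSeries_top :
    hilbSeries (⊤ : Ideal (PR K n)) = PowerSeries.mk 1 ^ (n + 1) := by
  have h1 := one_sub_X_pow_mul_hilbSeries_top (K := K) (n := n)
  have h2 : (1 - PowerSeries.X) ^ (n + 1) * (PowerSeries.mk 1 : PowerSeries ℤ) ^ (n + 1) = 1 := by
    rw [← mul_pow, one_sub_X_mul_mk_one, one_pow]
  linear_combination (PowerSeries.mk 1 ^ (n + 1)) * h1 - hilbSeries (⊤ : Ideal (PR K n)) * h2

/-- An ideal containing two coprime forms has an `h`-polynomial of codimension two. -/
lemma exists_hPolynomial (hn : 2 ≤ n) {I : Ideal (PR K n)} (hI : IsHomogIdeal I)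
    {F G : PR K n} {a b : ℕ} (hF0 : F ≠ 0) (hG0 : G ≠ 0) (hF : F.IsHomogeneous a)
    (hG : G.IsHomogeneous b) (hFI : F ∈ I) (hGI : G ∈ I) (hFG : IsRelPrime F G) :
    ∃ Q : Polynomial ℤ, quotSeries I =
      (1 - PowerSeries.X) ^ 2 * (Q : PowerSeries ℤ) * hilbSeries (⊤ : Ideal (PR K n)) := by
  obtain ⟨l, rfl⟩ := Nat.exists_eq_add_of_le' hn
  have hu := one_sub_X_mul_mk_one
  obtain ⟨p, hp⟩ := exists_polynomial_quotSeries (l + 2 + 1) I hI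
    fun i hi => absurd i.2 (by omega)
  have hpu : quotSeries I = (p : PowerSeries ℤ) * PowerSeries.mk 1 ^ (l + 1 + 2) := by
    rw [← hp, mul_right_comm, ← mul_pow, hu, one_pow, one_mul]
  have hJ := hilbSeries_basicDoubleLink isHomogIdeal_top hF0 hG0 hF hG trivial hFG
  have hJI : Ideal.span {G} * ⊤ ⊔ Ideal.span {F} ≤ I := by
    rw [Ideal.mul_top, sup_le_iff]
    simp [Ideal.span_le, hFI, hGI]
  let ga : Polynomial ℤ := ∑ i ∈ Finset.range a, Polynomial.X ^ i
  let gb : Polynomial ℤ := ∑ i ∈ Finset.range b, Polynomial.X ^ i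
  have hga : (1 - PowerSeries.X) * (ga : PowerSeries ℤ) = 1 - PowerSeries.X ^ a := by
    have := congrArg (fun q : Polynomial ℤ => (q : PowerSeries ℤ))
      (mul_neg_geom_sum (Polynomial.X : Polynomial ℤ) a)
    simpa [ga] using this
  have hgb : (1 - PowerSeries.X) * (gb : PowerSeries ℤ) = 1 - PowerSeries.X ^ b := by
    have := congrArg (fun q : Polynomial ℤ => (q : PowerSeries ℤ))
      (mul_neg_geom_sum (Polynomial.X : Polynomial ℤ) b)
    simpa [gb] using this
  have hqJ : quotSeries (Ideal.span {G} * ⊤ ⊔ Ideal.span {F}) =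
      ((ga * gb : Polynomial ℤ) : PowerSeries ℤ) * PowerSeries.mk 1 ^ (l + 1) := by
    have h2 : (1 - PowerSeries.X) ^ 2 * (PowerSeries.mk 1 : PowerSeries ℤ) ^ 2 = 1 := by
      rw [← mul_pow, hu, one_pow]
    rw [quotSeries, hJ, hilbSeries_top, Polynomial.coe_mul]
    have h3 : (1 - PowerSeries.X) ^ 2 * ((ga : PowerSeries ℤ) * (gb : PowerSeries ℤ)) =
        (1 - PowerSeries.X ^ a) * (1 - PowerSeries.X ^ b) := by
      rw [← hga, ← hgb]
      ring
    linear_combination (-PowerSeries.mk 1 ^ (l + 2 + 1)) * h3 +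
      ((ga : PowerSeries ℤ) * (gb : PowerSeries ℤ)) * PowerSeries.mk 1 ^ (l + 1) * h2
  obtain ⟨M, hM⟩ := exists_bound_coeff_mul_mk_one_pow (ga * gb) l
  have hb (t : ℕ) : |PowerSeries.coeff t (quotSeries I)| ≤ M * ((l + t).choose l : ℤ) := by
    rw [abs_of_nonneg (coeff_quotSeries_nonneg _ _)]
    refine (quotSeries_anti hJI t).trans ((le_abs_self _).trans ?_)
    rw [hqJ]
    exact hM t
  have hM0 : 0 ≤ M := by
    have := (abs_nonneg _).trans (hb 0)
    simpa using this
  obtain ⟨p1, hp1⟩ := exists_eq_one_sub_X_mul (p := p) (l := l + 1) (M := M) (by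
    intro t
    rw [← hpu]
    refine (hb t).trans (mul_le_mul_of_nonneg_left ?_ hM0)
    rw [show l + 1 + t = l + t + 1 by omega, Nat.choose_succ_succ]
    push_cast
    linarith [Nat.zero_le ((l + t).choose (l + 1))])
  have hpu1 : quotSeries I = (p1 : PowerSeries ℤ) * PowerSeries.mk 1 ^ (l + 2) := by
    rw [hpu, hp1, Polynomial.coe_mul, Polynomial.coe_sub, Polynomial.coe_one, Polynomial.coe_X]
    linear_combination (p1 : PowerSeries ℤ) * PowerSeries.mk 1 ^ (l + 2) * hu
  obtain ⟨Q, hQ⟩ := exists_eq_one_sub_X_mul (p := p1) (l := l) (M := M) (by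
    intro t
    rw [← hpu1]
    exact hb t)
  refine ⟨Q, ?_⟩
  rw [hpu, hp1, hQ, hilbSeries_top]
  simp only [Polynomial.coe_mul, Polynomial.coe_sub, Polynomial.coe_one, Polynomial.coe_X]
  ring

lemma not_le_span_singleton_of_two_le_idealHeight {I : Ideal (PR K n)} (hht : 2 ≤ idealHeight I)
    {p : PR K n} (hp : Prime p) : ¬ I ≤ Ideal.span {p} := by
  intro h
  have hP : (Ideal.span {p}).IsPrime := (Ideal.span_singleton_prime hp.ne_zero).2 hp
  have h1 : idealHeight I ≤ Order.height (⟨_, hP⟩ : PrimeSpectrum (PR K n)) :=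
    iInf₂_le (⟨_, hP⟩ : PrimeSpectrum (PR K n)) h
  rw [← PrimeSpectrum.height_eq_orderHeight] at h1
  have h2 := hht.trans (h1.trans (Ideal.height_span_singleton_le_one hp.not_isUnit))
  norm_num at h2

lemma exists_isHomogeneous_notMem_of_prime {I : Ideal (PR K n)} (hI : IsHomogIdeal I)
    (hht : 2 ≤ idealHeight I) {p : PR K n} (hp : Prime p) :
    ∃ e, ∃ y ∈ I, y.IsHomogeneous e ∧ ¬ p ∣ y := by
  obtain ⟨x, hx, hxp⟩ := SetLike.not_le_iff_exists.1
    (not_le_span_singleton_of_two_le_idealHeight hht hp)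
  by_contra! h
  refine hxp ?_
  rw [← sum_homogeneousComponent x]
  exact Ideal.sum_mem _ fun e _ => Ideal.mem_span_singleton.2
    (h e _ (hI x hx e) (homogeneousComponent_isHomogeneous _ _))

lemma exists_not_dvd_X (hn : 1 ≤ n) {p : PR K n} (hp : Prime p) : ∃ i, ¬ p ∣ X i := by
  by_contra! h
  obtain ⟨n, rfl⟩ := Nat.exists_eq_add_of_le' hn
  have h0 := hp.associated_of_dvd (X_prime (R := K) (i := (0 : Fin (n + 1 + 1)))) (h 0)
  have h1 := hp.associated_of_dvd (X_prime (R := K) (i := (1 : Fin (n + 1 + 1)))) (h 1)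
  have := X_dvd_X.1 (h0.symm.trans h1).dvd
  simp at this

/-- Homogeneous prime avoidance for finitely many principal primes. -/
lemma exists_isHomogeneous_not_dvd [Infinite K] (hn : 1 ≤ n) {I : Ideal (PR K n)}
    (hI : IsHomogIdeal I) (hht : 2 ≤ idealHeight I) (S : Finset (PR K n))
    (hS : ∀ p ∈ S, Prime p) : ∃ D, ∃ G ∈ I, G.IsHomogeneous D ∧ ∀ p ∈ S, ¬ p ∣ G := by
  have h1 (p : S) := exists_isHomogeneous_notMem_of_prime hI hht (hS p p.2)
  choose e y hyI hy hpy using h1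
  have h2 (p : S) := exists_not_dvd_X hn (hS p p.2)
  choose i hi using h2
  let D := Finset.univ.sup e
  let V (p : S) : Submodule K (degPart I D) :=
    (Submodule.restrictScalars K (Ideal.span {(p : PR K n)})).comap (degPart I D).subtype
  have hV (p : S) : V p ≠ ⊤ := by
    intro htop
    have hz : X (i p) ^ (D - e p) * y p ∈ degPart I D := by
      refine mem_degPart.2 ⟨I.mul_mem_left _ (hyI p), ?_⟩
      have := (isHomogeneous_X_pow (R := K) (i p) (D - e p)).mul (hy p)
      rwa [Nat.sub_add_cancel (Finset.le_sup (f := e) (Finset.mem_univ p))] at this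
    have hmem : (⟨_, hz⟩ : degPart I D) ∈ V p := htop ▸ trivial
    have hdvd : (p : PR K n) ∣ X (i p) ^ (D - e p) * y p := Ideal.mem_span_singleton.1 hmem
    rcases (hS p p.2).dvd_or_dvd hdvd with h | h
    · exact hi p ((hS p p.2).dvd_of_dvd_pow h)
    · exact hpy p h
  have hne : ⋃ p, (V p : Set (degPart I D)) ≠ Set.univ := by
    intro h
    obtain ⟨p, hp⟩ := Subspace.exists_eq_top_of_iUnion_eq_univ h
    exact hV p hp
  obtain ⟨⟨G, hG⟩, hGV⟩ := (Set.ne_univ_iff_exists_notMem _).1 hne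
  refine ⟨D, G, (mem_degPart.1 hG).1, (mem_degPart.1 hG).2, fun p hp hdvd => hGV ?_⟩
  exact Set.mem_iUnion.2 ⟨⟨p, hp⟩, Ideal.mem_span_singleton.2 hdvd⟩

lemma exists_isHomogeneous_isRelPrime [Infinite K] (hn : 1 ≤ n) {I : Ideal (PR K n)}
    (hI : IsHomogIdeal I) (hht : 2 ≤ idealHeight I) {F : PR K n} (hF : F ≠ 0) :
    ∃ D, ∃ G ∈ I, G.IsHomogeneous D ∧ G ≠ 0 ∧ IsRelPrime F G := by
  classical
  obtain ⟨D, G, hGI, hG, hGS⟩ := exists_isHomogeneous_not_dvd hn hI hht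
    (insert (X 0) (UniqueFactorizationMonoid.factors F).toFinset) (by
      intro p hp
      rcases Finset.mem_insert.1 hp with rfl | hp
      · exact X_prime
      · exact UniqueFactorizationMonoid.prime_of_factor p (Multiset.mem_toFinset.1 hp))
  refine ⟨D, G, hGI, hG, ?_, ?_⟩
  · rintro rfl
    exact hGS _ (Finset.mem_insert_self _ _) (dvd_zero _)
  · rw [UniqueFactorizationMonoid.isRelPrime_iff_no_prime_factors hF]
    intro d hdF hdG hd
    obtain ⟨q, hq, hdq⟩ :=
      UniqueFactorizationMonoid.exists_mem_factors_of_dvd hF hd.irreducible hdF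
    exact hGS q (Finset.mem_insert_of_mem (Multiset.mem_toFinset.2 hq)) (hdq.symm.dvd.trans hdG)

end HVector

section HVectorStep

variable {K : Type} [Field K] {n : ℕ}

/-- `f` is the `h`-vector of `R/I`, normalized as if `R/I` had codimension two. -/
def IsHVector (I : Ideal (PR K n)) (f : ℕ → ℤ) : Prop :=
  quotSeries I = (1 - PowerSeries.X) ^ 2 * PowerSeries.mk f * hilbSeries (⊤ : Ideal (PR K n))

lemma IsHVector.hilbQuot_eq {I J : Ideal (PR K n)} {f : ℕ → ℤ} (hI : IsHVector I f)
    (hJ : IsHVector J f) (t : ℤ) : hilbQuot I t = hilbQuot J t := by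
  have h := congrArg (PowerSeries.coeff t.toNat) (hI.trans hJ.symm)
  simp only [quotSeries, hilbSeries, map_sub, PowerSeries.coeff_mk] at h
  unfold hilbQuot
  split_ifs
  · rfl
  · change _ - (Module.finrank K (degPart I t.toNat) : ℤ) =
      _ - (Module.finrank K (degPart J t.toNat) : ℤ)
    linarith

lemma isHVector_top : IsHVector (⊤ : Ideal (PR K n)) 0 := by
  have h : (PowerSeries.mk 0 : PowerSeries ℤ) = 0 := by
    ext
    simp
  rw [IsHVector, quotSeries_top, h]
  simp

lemma IsHVector.basicDoubleLink {I : Ideal (PR K n)} {f : ℕ → ℤ} (hf : IsHVector I f)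
    (hI : IsHomogIdeal I) {F L : PR K n} (hF0 : F ≠ 0) (hL0 : L ≠ 0) {d : ℕ}
    (hF : F.IsHomogeneous d) (hL : L.IsHomogeneous 1) (hFI : F ∈ I) (hFL : IsRelPrime F L) :
    IsHVector (Ideal.span {L} * I + Ideal.span {F})
      (fun t => (if t = 0 then 0 else f (t - 1)) + if t < d then 1 else 0) := by
  have h := hilbSeries_basicDoubleLink hI hF0 hL0 hF hL hFI hFL
  have h1 : (PowerSeries.mk fun t => (if t = 0 then 0 else f (t - 1)) + if t < d then 1 else 0) =
      PowerSeries.X * PowerSeries.mk f +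
        (PowerSeries.mk 1 - PowerSeries.X ^ d * PowerSeries.mk 1) := by
    ext t
    rw [map_add, map_sub, PowerSeries.coeff_X_pow_mul', PowerSeries.coeff_mk, PowerSeries.coeff_mk]
    rcases t with _ | t
    · rcases d with _ | d <;> simp
    · rw [PowerSeries.coeff_succ_X_mul]
      by_cases hd : t + 1 < d
      · simp [hd, not_le.2 hd]
      · simp [hd, not_lt.1 hd]
  unfold IsHVector quotSeries at *
  rw [Submodule.add_eq_sup, h, h1, pow_one]
  linear_combination PowerSeries.X * hf + (PowerSeries.X ^ d - 1) * (1 - PowerSeries.X) *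
    hilbSeries (⊤ : Ideal (PR K n)) * one_sub_X_mul_mk_one

lemma IsHVector.eq_of_lt {I : Ideal (PR K n)} {f : ℕ → ℤ} (hf : IsHVector I f) {α : ℕ}
    (hα : ∀ t < α, PowerSeries.coeff t (hilbSeries I) = 0) {t : ℕ} (ht : t < α) :
    f t = t + 1 := by
  obtain ⟨h, hh⟩ := PowerSeries.X_pow_dvd_iff.2 hα
  have h1 := one_sub_X_pow_mul_hilbSeries_top (K := K) (n := n)
  have h2 : (1 - PowerSeries.X) ^ 2 * (PowerSeries.mk 1 : PowerSeries ℤ) ^ 2 = 1 := by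
    rw [← mul_pow, one_sub_X_mul_mk_one, one_pow]
  have h3 : PowerSeries.mk 1 ^ 2 - PowerSeries.mk f = PowerSeries.X ^ α *
      (h * (1 - PowerSeries.X) ^ (n + 1) * PowerSeries.mk 1 ^ 2) := by
    unfold IsHVector quotSeries at hf
    rw [hh] at hf
    linear_combination PowerSeries.mk 1 ^ 2 * (1 - PowerSeries.X) ^ (n + 1) * hf
      - PowerSeries.mk 1 ^ 2 * h1 + PowerSeries.mk f * h2 +
      PowerSeries.mk 1 ^ 2 * (1 - PowerSeries.X) ^ 2 * PowerSeries.mk f * h1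
  have h4 := PowerSeries.X_pow_dvd_iff.1 (Dvd.intro _ h3.symm) t ht
  rw [map_sub, coeff_mk_one_pow 1 t, PowerSeries.coeff_mk, Nat.choose_one_right] at h4
  push_cast at h4
  linarith

end HVectorStep

section FreeResolution

lemma hasLen1FreeRes_top {A : Type} [CommRing A] : HasLen1FreeRes (⊤ : Ideal A) := by
  refine ⟨0, 1, 0, LinearMap.proj 0, fun _ _ _ => Subsingleton.elim _ _, ?_, ?_⟩
  · rw [LinearMap.range_zero, LinearMap.ker_eq_bot']
    intro m hm
    ext i
    rwa [Subsingleton.elim i 0]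
  · rw [LinearMap.range_eq_top]
    exact fun x => ⟨fun _ => x, rfl⟩

lemma HasLen1FreeRes.basicDoubleLink {A : Type} [CommRing A] [IsDomain A] {J : Ideal A}
    (hJ : HasLen1FreeRes J) {F L : A} (hFJ : F ∈ J) (hL0 : L ≠ 0)
    (hFL : ∀ x, L ∣ F * x → L ∣ x) :
    HasLen1FreeRes (Ideal.span {L} * J + Ideal.span {F}) := by
  obtain ⟨p, q, f, g, hf, hfg, hg⟩ := hJ
  obtain ⟨c, hc⟩ : ∃ c, g c = F := by
    rw [← hg] at hFJ
    exact hFJ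
  let sp (k : ℕ) : (Fin (k + 1) → A) ≃ₗ[A] A × (Fin k → A) :=
    (Fin.consLinearEquiv A fun _ => A).symm
  let f' : A × (Fin p → A) →ₗ[A] A × (Fin q → A) :=
    (LinearMap.toSpanSingleton A (A × (Fin q → A)) (L, -c)).comp (LinearMap.fst A A _) +
      (LinearMap.inr A A _).comp (f.comp (LinearMap.snd A A _))
  let g' : A × (Fin q → A) →ₗ[A] A :=
    (LinearMap.toSpanSingleton A A F).comp (LinearMap.fst A A _) +
      L • g.comp (LinearMap.snd A A _)
  have hf' (x : A × (Fin p → A)) : f' x = (x.1 * L, - (x.1 • c) + f x.2) := by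
    simp [f']
  have hg' (x : A × (Fin q → A)) : g' x = x.1 * F + L * g x.2 := by
    simp [g']
  have hgf (y : Fin p → A) : g (f y) = 0 := by
    have : f y ∈ LinearMap.ker g := hfg ▸ LinearMap.mem_range_self f y
    exact this
  have hinj : Function.Injective f' := by
    rw [← LinearMap.ker_eq_bot, LinearMap.ker_eq_bot']
    rintro ⟨a, y⟩ hay
    rw [hf', Prod.ext_iff] at hay
    have ha : a = 0 := by simpa [hL0] using hay.1
    subst ha
    have hy : f y = 0 := by simpa using hay.2
    rw [(map_eq_zero_iff f hf).1 hy]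
    rfl
  have hker : LinearMap.ker g' = LinearMap.range f' := by
    ext ⟨a, y⟩
    rw [LinearMap.mem_ker, hg', LinearMap.mem_range]
    constructor
    · intro h
      obtain ⟨b, rfl⟩ := hFL a ⟨-g y, by linear_combination h⟩
      have hy : y + b • c ∈ LinearMap.ker g := by
        rw [LinearMap.mem_ker, map_add, map_smul, hc, smul_eq_mul]
        apply mul_left_cancel₀ hL0
        linear_combination h
      rw [hfg] at hy
      obtain ⟨z, hz⟩ := hy
      refine ⟨(b, z), ?_⟩
      rw [hf', hz, mul_comm]
      simp
    · rintro ⟨⟨b, z⟩, hbz⟩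
      rw [hf', Prod.ext_iff] at hbz
      obtain ⟨rfl, rfl⟩ := hbz
      simp only [map_add, map_neg, map_smul, hc, hgf, smul_eq_mul]
      ring
  have hrange : LinearMap.range g' = Ideal.span {L} * J + Ideal.span {F} := by
    ext x
    rw [LinearMap.mem_range, Submodule.add_eq_sup, Submodule.mem_sup]
    constructor
    · rintro ⟨⟨a, y⟩, rfl⟩
      exact ⟨L * g y, Ideal.mem_span_singleton_mul.2 ⟨g y, hg ▸ LinearMap.mem_range_self g y, rfl⟩,
        a * F, Ideal.mem_span_singleton'.2 ⟨a, rfl⟩, by rw [hg', add_comm]⟩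
    · rintro ⟨u, hu, v, hv, rfl⟩
      obtain ⟨w, hw, rfl⟩ := Ideal.mem_span_singleton_mul.1 hu
      obtain ⟨a, rfl⟩ := Ideal.mem_span_singleton'.1 hv
      rw [← hg] at hw
      obtain ⟨y, rfl⟩ := hw
      exact ⟨(a, y), by rw [hg', add_comm]⟩
  refine ⟨p + 1, q + 1, (sp q).symm.toLinearMap.comp (f'.comp (sp p).toLinearMap),
    g'.comp (sp q).toLinearMap, ?_, ?_, ?_⟩
  · exact (sp q).symm.injective.comp (hinj.comp (sp p).injective)
  · ext x
    rw [LinearMap.mem_ker, LinearMap.comp_apply, ← LinearMap.mem_ker, hker]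
    constructor
    · rintro ⟨y, hy⟩
      exact ⟨(sp p).symm y, by simp [hy]⟩
    · rintro ⟨y, rfl⟩
      exact ⟨sp p y, by simp⟩
  · rw [LinearMap.range_comp_of_range_eq_top _ (LinearEquiv.range _), hrange]

end FreeResolution

section ACM

variable {K : Type} [Field K] {n : ℕ}

lemma isRelPrime_X_pow_X {i j : Fin (n + 1)} (hij : i ≠ j) (d : ℕ) :
    IsRelPrime ((X i : PR K n) ^ d) (X j) := by
  refine IsRelPrime.pow_left ?_
  rw [(X_prime (R := K) (i := i)).irreducible.isRelPrime_iff_not_dvd, X_dvd_X]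
  simp [hij]

lemma exists_hasLen1FreeRes_isHVector {i j : Fin (n + 1)} (hij : i ≠ j) (s : ℕ) : ∀ f : ℕ → ℤ,
    (∀ t, 0 ≤ f t) → (∀ t < s, f t = t + 1) → (∀ t, s ≤ t + 1 → f (t + 1) ≤ f t) →
    (∀ t, f t ≤ s) → (∃ N, ∀ t, N ≤ t → f t = 0) →
    ∃ J : Ideal (PR K n), IsHomogIdeal J ∧ IsHVector J f ∧ HasLen1FreeRes J ∧ X j ^ s ∈ J ∧
      (∀ t, f t = 0 → X i ^ t ∈ J) ∧ (s ≠ 0 → J ≤ Ideal.span {X i, X j}) := by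
  induction s with
  | zero =>
    intro f h0 _ _ hs _
    obtain rfl : f = 0 := by
      funext t
      exact le_antisymm (by simpa using hs t) (h0 t)
    exact ⟨⊤, isHomogIdeal_top, isHVector_top, hasLen1FreeRes_top, trivial, fun _ _ => trivial,
      fun h => absurd rfl h⟩
  | succ s ih =>
    intro f h0 hlt hanti hs ⟨N, hN⟩
    classical
    have hex : ∃ d, f d = 0 := ⟨N, hN N le_rfl⟩
    let d := Nat.find hex
    have hd : f d = 0 := Nat.find_spec hex
    have hdmin (t : ℕ) (ht : t < d) : 1 ≤ f t := by
      have := Nat.find_min hex ht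
      have := h0 t
      omega
    have hsd : s + 1 ≤ d := by
      by_contra! h
      have := hlt d h
      omega
    have hdge (t : ℕ) (ht : d ≤ t) : f t = 0 := by
      induction t, ht using Nat.le_induction with
      | base => exact hd
      | succ t ht iht =>
        have := hanti t (by omega)
        have := h0 (t + 1)
        omega
    obtain ⟨J, hJ, hJf, hJres, hj, hi, -⟩ := ih (fun t => max (f (t + 1) - 1) 0)
      (fun t => le_max_right _ _)
      (fun t ht => by
        have := hlt (t + 1) (by omega)
        push_cast at this
        simp only [this]
        omega)
      (fun t ht => by
        have := hanti (t + 1) (by omega)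
        exact max_le_max_right _ (by omega))
      (fun t => by
        have := hs (t + 1)
        push_cast at this
        exact max_le (by omega) (by omega))
      ⟨N, fun t ht => by simp [hN (t + 1) (by omega)]⟩
    have hdJ : (X i : PR K n) ^ d ∈ J := hi d (by simp [hdge (d + 1) (by omega)])
    have hrel := isRelPrime_X_pow_X (K := K) hij d
    have hX0 : (X i : PR K n) ^ d ≠ 0 := pow_ne_zero _ (X_ne_zero i)
    refine ⟨Ideal.span {X j} * J + Ideal.span {X i ^ d},
      (hJ.span_singleton_mul (isHomogeneous_X K j)).sup
        (isHomogIdeal_span_singleton (isHomogeneous_X_pow i d)), ?_,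
      hJres.basicDoubleLink hdJ (X_ne_zero j) fun x hx => hrel.symm.dvd_of_dvd_mul_left hx,
      ?_, ?_, ?_⟩
    · convert hJf.basicDoubleLink hJ hX0 (X_ne_zero j) (isHomogeneous_X_pow i d)
        (isHomogeneous_X K j) hdJ hrel using 1
      funext t
      rcases t with _ | t
      · have := hlt 0 (by omega)
        simp [this, show 0 < d by omega]
      · by_cases ht : t + 1 < d
        · have := hdmin _ ht
          simp [ht, this]
        · simp [ht, hdge (t + 1) (by omega)]
    · rw [pow_succ']
      exact Ideal.mem_sup_left (Ideal.mem_span_singleton_mul.2 ⟨_, hj, rfl⟩)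
    · intro t ht
      have htd : d ≤ t := Nat.find_min' hex ht
      exact Ideal.mem_sup_right (Ideal.mem_span_singleton.2 (pow_dvd_pow _ htd))
    · intro _
      have hXi : (X i : PR K n) ∈ Ideal.span {X i, X j} := Ideal.subset_span (by simp)
      refine sup_le (Ideal.mul_le_left.trans ?_) ?_
      · rw [Ideal.span_singleton_le_iff_mem]
        exact Ideal.subset_span (by simp)
      · rw [Ideal.span_singleton_le_iff_mem]
        exact Ideal.pow_mem_of_mem _ hXi _ (by omega)

lemma span_X_pair_ne_top (i j : Fin (n + 1)) : Ideal.span {(X i : PR K n), X j} ≠ ⊤ := by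
  intro h
  have h1 : Ideal.span {(X i : PR K n), X j} ≤ RingHom.ker (constantCoeff (σ := Fin (n + 1))
      (R := K)) := by
    rw [Ideal.span_le]
    rintro x (rfl | rfl) <;> simp [RingHom.mem_ker]
  have h2 := h1 (h ▸ trivial : (1 : PR K n) ∈ Ideal.span {(X i : PR K n), X j})
  simp [RingHom.mem_ker] at h2

lemma idealHeight_eq_two {i j : Fin (n + 1)} (hij : i ≠ j) {J : Ideal (PR K n)} {a b : ℕ}
    (hi : X i ^ a ∈ J) (hj : X j ^ b ∈ J) (hJ : J ≤ Ideal.span {X i, X j}) :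
    idealHeight J = 2 := by
  apply le_antisymm
  · obtain ⟨P, hP⟩ := Ideal.nonempty_minimalPrimes (span_X_pair_ne_top (K := K) i j)
    have hPp : P.IsPrime := hP.1.1
    have h1 : idealHeight J ≤ Order.height (⟨P, hPp⟩ : PrimeSpectrum (PR K n)) :=
      iInf₂_le (⟨P, hPp⟩ : PrimeSpectrum (PR K n)) (hJ.trans hP.1.2)
    rw [← PrimeSpectrum.height_eq_orderHeight] at h1
    classical
    have h2 := Ideal.height_le_card_of_mem_minimalPrimes_span_finset
      (s := ({X i, X j} : Finset (PR K n))) (p := P) (by rwa [Finset.coe_pair])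
    exact h1.trans (h2.trans (Nat.cast_le.2 Finset.card_le_two))
  · refine le_iInf₂ fun P hP => ?_
    have hiP : (X i : PR K n) ∈ P.asIdeal := P.2.mem_of_pow_mem _ (hP hi)
    have hjP : (X j : PR K n) ∈ P.asIdeal := P.2.mem_of_pow_mem _ (hP hj)
    have hXp : (Ideal.span {(X i : PR K n)}).IsPrime :=
      (Ideal.span_singleton_prime (X_ne_zero i)).2 X_prime
    have h1 : Ideal.span {(X i : PR K n)} < P.asIdeal := by
      refine SetLike.lt_iff_le_and_exists.2
        ⟨(Ideal.span_singleton_le_iff_mem _).2 hiP, X j, hjP, ?_⟩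
      rw [Ideal.mem_span_singleton, X_dvd_X]
      simp [hij]
    have h2 : (⊥ : Ideal (PR K n)) < Ideal.span {(X i : PR K n)} := by
      rw [bot_lt_iff_ne_bot, Ne, Ideal.span_singleton_eq_bot]
      exact X_ne_zero i
    have hPp := P.2
    have h3 := Ideal.height_add_one_le_of_lt_of_isPrime h1
    have h4 := Ideal.height_add_one_le_of_lt_of_isPrime h2
    rw [← PrimeSpectrum.height_eq_orderHeight]
    calc (2 : ℕ∞) = 0 + 1 + 1 := by norm_num
      _ ≤ (⊥ : Ideal (PR K n)).height + 1 + 1 := by gcongr; simp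
      _ ≤ _ := by gcongr
      _ ≤ _ := h3

lemma numACM_of_isHVector (hn : 1 ≤ n) {I : Ideal (PR K n)} {f : ℕ → ℤ} (hf : IsHVector I f)
    {s : ℕ} (hs0 : s ≠ 0) (hlt : ∀ t < s, f t = t + 1)
    (hanti : ∀ t, s ≤ t + 1 → f (t + 1) ≤ f t) (hN : ∃ N, ∀ t, N ≤ t → f t = 0) :
    NumACM I := by
  have hij : (0 : Fin (n + 1)) ≠ Fin.last n := by
    rw [Ne, Fin.ext_iff]
    simp
    omega
  have hanti' (t u : ℕ) (ht : s ≤ t + 1) (htu : t ≤ u) : f u ≤ f t := by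
    induction u, htu using Nat.le_induction with
    | base => exact le_rfl
    | succ u hu ih => exact (hanti u (by omega)).trans ih
  obtain ⟨N, hN⟩ := hN
  have h0 (t : ℕ) : 0 ≤ f t := by
    by_cases ht : t < s
    · have := hlt t ht
      omega
    · rw [← hN (max t N) (le_max_right _ _)]
      exact hanti' _ _ (by omega) (le_max_left _ _)
  have hs (t : ℕ) : f t ≤ s := by
    by_cases ht : t < s
    · have := hlt t ht
      omega
    · have h1 := hanti' (s - 1) t (by omega) (by omega)
      have h2 := hlt (s - 1) (by omega)
      omega
  obtain ⟨J, hJ, hJf, hres, hj, hi, hle⟩ :=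
    exists_hasLen1FreeRes_isHVector (K := K) hij s f h0 hlt hanti hs ⟨N, hN⟩
  refine ⟨J, ?_, hJ, idealHeight_eq_two hij (hi N (hN N le_rfl)) hj (hle hs0), hres,
    hJf.hilbQuot_eq hf⟩
  rintro rfl
  exact span_X_pair_ne_top _ _ (top_le_iff.1 (hle hs0))

end ACM

section Chain

/-- The `h`-vectors obtained from `f` by successive basic double links of types `(d k, 1)`. -/
def linkVec (d : ℕ → ℕ) (f : ℕ → ℤ) : ℕ → ℕ → ℤ
  | 0 => f
  | k + 1 => fun t => (if t = 0 then 0 else linkVec d f k (t - 1)) + if t < d k then 1 else 0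

lemma linkVec_of_lt {d : ℕ → ℕ} (hd : ∀ k, k < d k) (f : ℕ → ℤ) {k t : ℕ} (ht : t < k) :
    linkVec d f k t = t + 1 := by
  induction k generalizing t with
  | zero => omega
  | succ k ih =>
    have := hd k
    rcases t with _ | t
    · simp [linkVec, show 0 < d k by omega]
    · simp [linkVec, ih (t := t) (by omega), show t + 1 < d k by omega]

lemma linkVec_add (d : ℕ → ℕ) (f : ℕ → ℤ) (k s : ℕ) :
    linkVec d f k (k + s) = f s + ∑ j ∈ Finset.range k, if j + 1 + s < d j then 1 else 0 := by
  induction k with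
  | zero => simp [linkVec]
  | succ k ih =>
    rw [Finset.sum_range_succ, ← add_assoc, ← ih]
    simp only [linkVec]
    rw [if_neg (by omega), show k + 1 + s - 1 = k + s by omega]

lemma sum_range_mul_ite {C : ℕ} (hC : 0 < C) (M x : ℕ) :
    ∑ j ∈ Finset.range (C * M), (if x ≤ j / C then (1 : ℤ) else 0) = C * ((M - x : ℕ) : ℤ) := by
  induction M with
  | zero => simp
  | succ M ih =>
    rw [Nat.mul_succ, Finset.sum_range_add, ih]
    have h : ∀ i ∈ Finset.range C, (if x ≤ (C * M + i) / C then (1 : ℤ) else 0) =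
        if x ≤ M then 1 else 0 := by
      intro i hi
      rw [Nat.mul_add_div hC, Nat.div_eq_of_lt (Finset.mem_range.1 hi), add_zero]
    rw [Finset.sum_congr rfl h, Finset.sum_const, Finset.card_range, nsmul_eq_mul]
    split_ifs with hx
    · rw [Nat.succ_sub hx]
      push_cast
      ring
    · rw [Nat.sub_eq_zero_of_le (by omega), Nat.sub_eq_zero_of_le (by omega)]
      simp

/-- Repeating each difference `d k - k` often enough makes the `h`-vector unimodal. -/
lemma exists_linkVec_antitone {f : ℕ → ℤ} {α N : ℕ} (hα : 0 < α) (hlt : ∀ t < α, f t = t + 1)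
    (hN : ∀ t, N ≤ t → f t = 0) :
    ∃ (m : ℕ) (d : ℕ → ℕ), StrictMono d ∧ (∀ k, α ≤ d k) ∧
      (∀ t < m + α, linkVec d f m t = t + 1) ∧
      (∀ t, m + α ≤ t + 1 → linkVec d f m (t + 1) ≤ linkVec d f m t) ∧
      (∃ N, ∀ t, N ≤ t → linkVec d f m t = 0) := by
  obtain ⟨C, hC0, hC⟩ : ∃ C : ℕ, 0 < C ∧ ∀ u, f (u + 1) - f u ≤ C := by
    refine ⟨1 + ∑ u ∈ Finset.range N, (f (u + 1) - f u).natAbs, by omega, fun u => ?_⟩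
    by_cases hu : u < N
    · have := Finset.single_le_sum (f := fun u => (f (u + 1) - f u).natAbs)
        (fun _ _ => Nat.zero_le _) (Finset.mem_range.2 hu)
      omega
    · rw [hN u (by omega), hN (u + 1) (by omega)]
      omega
  let d : ℕ → ℕ := fun k => α + 1 + k + k / C
  have hd (k : ℕ) : d k = α + 1 + k + k / C := rfl
  have hlink (s : ℕ) : linkVec d f (C * N) (C * N + s) =
      f s + C * ((N - (s + 1 - α) : ℕ) : ℤ) := by
    rw [linkVec_add, ← sum_range_mul_ite hC0]
    congr 1
    refine Finset.sum_congr rfl fun j _ => ?_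
    have : j + 1 + s < d j ↔ s + 1 - α ≤ j / C := by
      rw [hd]
      generalize j / C = q
      omega
    simp only [this]
  refine ⟨C * N, d, strictMono_nat_of_lt_succ fun k => ?_, fun k => ?_, fun t ht => ?_,
    fun t ht => ?_, C * N + (N + α), fun t ht => ?_⟩
  · have : k / C ≤ (k + 1) / C := Nat.div_le_div_right (Nat.le_succ k)
    simp only [hd]
    omega
  · rw [hd]
    generalize k / C = q
    omega
  · by_cases htm : t < C * N
    · exact linkVec_of_lt (fun k => by rw [hd]; generalize k / C = q; omega) f htm
    · obtain ⟨s, rfl⟩ := Nat.exists_eq_add_of_le (not_lt.1 htm)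
      rw [hlink, hlt s (by omega), Nat.sub_eq_zero_of_le (by omega : s + 1 ≤ α), Nat.sub_zero]
      push_cast
      ring
  · obtain ⟨s, rfl⟩ := Nat.exists_eq_add_of_le (by omega : C * N ≤ t)
    rw [add_assoc, hlink, hlink]
    by_cases hs : s + 1 - α < N
    · have : ((N - (s + 1 - α) : ℕ) : ℤ) = ((N - (s + 1 + 1 - α) : ℕ) : ℤ) + 1 := by omega
      rw [this]
      linarith [hC s]
    · rw [hN s (by omega), hN (s + 1) (by omega), Nat.sub_eq_zero_of_le (by omega),
        Nat.sub_eq_zero_of_le (by omega)]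
  · obtain ⟨s, rfl⟩ := Nat.exists_eq_add_of_le (by omega : C * N ≤ t)
    rw [hlink, hN s (by omega), Nat.sub_eq_zero_of_le (by omega)]
    simp

variable {K : Type} [Field K] {n : ℕ}

/-- The successive basic double links of `I` along `F 0, F 1, …` and a linear form `L`. -/
def linkIdeal (L : PR K n) (F : ℕ → PR K n) (I : Ideal (PR K n)) : ℕ → Ideal (PR K n)
  | 0 => I
  | k + 1 => Ideal.span {L} * linkIdeal L F I k + Ideal.span {F k}

lemma mem_linkIdeal (L : PR K n) {F : ℕ → PR K n} {I : Ideal (PR K n)} (hF : F 0 ∈ I)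
    (hdvd : ∀ k, F k ∣ F (k + 1)) (k : ℕ) : F k ∈ linkIdeal L F I k := by
  cases k with
  | zero => exact hF
  | succ k => exact Ideal.mem_sup_right (Ideal.mem_span_singleton.2 (hdvd k))

lemma isHomogIdeal_linkIdeal {L : PR K n} {F : ℕ → PR K n} {I : Ideal (PR K n)}
    (hI : IsHomogIdeal I) (hL : L.IsHomogeneous 1) {d : ℕ → ℕ}
    (hF : ∀ k, (F k).IsHomogeneous (d k)) (k : ℕ) : IsHomogIdeal (linkIdeal L F I k) := by
  induction k with
  | zero => exact hI
  | succ k ih => exact (ih.span_singleton_mul hL).sup (isHomogIdeal_span_singleton (hF k))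

lemma IsHVector.linkIdeal {L : PR K n} {F : ℕ → PR K n} {I : Ideal (PR K n)} {f : ℕ → ℤ}
    (hf : IsHVector I f) (hI : IsHomogIdeal I) (hL : L.IsHomogeneous 1) (hL0 : L ≠ 0) {d : ℕ → ℕ}
    (hF : ∀ k, (F k).IsHomogeneous (d k)) (hF0 : ∀ k, F k ≠ 0) (hFI : F 0 ∈ I)
    (hdvd : ∀ k, F k ∣ F (k + 1)) (hFL : ∀ k, IsRelPrime (F k) L) (k : ℕ) :
    IsHVector (linkIdeal L F I k) (linkVec d f k) := by
  induction k with
  | zero => exact hf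
  | succ k ih =>
    exact ih.basicDoubleLink (isHomogIdeal_linkIdeal hI hL hF k) (hF0 k) hL0 (hF k) hL
      (mem_linkIdeal L hFI hdvd k) (hFL k)

lemma exists_linear_isRelPrime [Infinite K] (hn : 1 ≤ n) {F : PR K n} (hF0 : F ≠ 0) :
    ∃ L : PR K n, L.IsHomogeneous 1 ∧ L ≠ 0 ∧ ∀ e, IsRelPrime (X 0 ^ e * F) L := by
  obtain ⟨n, rfl⟩ := Nat.exists_eq_add_of_le' hn
  obtain ⟨a, ha⟩ : ∃ a, eval a (X 0 * F) ≠ 0 := by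
    by_contra! h
    exact mul_ne_zero (X_ne_zero 0) hF0 (MvPolynomial.funext fun a => by rw [h a, map_zero])
  rw [map_mul, eval_X, mul_ne_zero_iff] at ha
  let L : PR K (n + 1) := C (a 1) * X 0 - C (a 0) * X 1
  have hL : L.IsHomogeneous 1 :=
    (isHomogeneous_C_mul_X _ _).sub (isHomogeneous_C_mul_X _ _)
  have hcoeff : coeff (Finsupp.single 1 1) L = - a 0 := by
    simp [L, coeff_C_mul, coeff_X, Finsupp.single_left_inj]
  have hL0 : L ≠ 0 := by
    intro h
    rw [h, coeff_zero] at hcoeff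
    exact ha.1 (neg_eq_zero.1 hcoeff.symm)
  have hirr : Irreducible L := by
    refine irreducible_of_totalDegree_eq_one (hL.totalDegree hL0) fun x hx => ?_
    have := hx (Finsupp.single 1 1)
    rw [hcoeff] at this
    exact isUnit_of_dvd_unit this (neg_ne_zero.2 ha.1).isUnit
  refine ⟨L, hL, hL0, fun e => ((hirr.isRelPrime_iff_not_dvd).2 ?_).symm⟩
  rintro ⟨G, hG⟩
  have := congrArg (eval a) hG
  simp [L, mul_comm (a 1), ha.1, ha.2] at this

lemma isRegSeq_of_isRelPrime {F L : PR K n} (hF0 : F ≠ 0) (hFL : IsRelPrime F L) :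
    IsRegSeq F L := by
  refine ⟨(IsRegular.of_ne_zero hF0).left.isSMulRegular, ?_⟩
  rw [isSMulRegular_iff_right_eq_zero_of_smul]
  intro x hx
  obtain ⟨x, rfl⟩ := Ideal.Quotient.mk_surjective x
  rw [smul_eq_mul, ← map_mul, Ideal.Quotient.eq_zero_iff_dvd] at hx
  rw [Ideal.Quotient.eq_zero_iff_dvd]
  exact hFL.dvd_of_dvd_mul_left hx

/-- A nonzero form of minimal degree in a homogeneous ideal. -/
lemma exists_initial_form {I : Ideal (PR K n)} (hI : IsHomogIdeal I) (hI0 : I ≠ ⊥) (hIp : I ≠ ⊤) :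
    ∃ α, 0 < α ∧ (∃ F ∈ I, F ≠ 0 ∧ F.IsHomogeneous α) ∧
      ∀ t < α, PowerSeries.coeff t (hilbSeries I) = 0 := by
  classical
  have hex : ∃ t, ∃ F ∈ I, F ≠ 0 ∧ F.IsHomogeneous t := by
    obtain ⟨x, hx, hx0⟩ := Submodule.exists_mem_ne_zero_of_ne_bot hI0
    by_contra! h
    apply hx0
    rw [← sum_homogeneousComponent x]
    refine Finset.sum_eq_zero fun d _ => ?_
    by_contra h0
    exact h d _ (hI x hx d) h0 (homogeneousComponent_isHomogeneous d x)
  refine ⟨Nat.find hex, ?_, Nat.find_spec hex, fun t ht => ?_⟩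
  · rw [Nat.find_pos]
    rintro ⟨F, hF, hF0, hFh⟩
    apply hIp
    obtain ⟨c, rfl⟩ : ∃ c, F = C c := ⟨_, totalDegree_eq_zero_iff_eq_C.1 (hFh.totalDegree hF0)⟩
    exact Ideal.eq_top_of_isUnit_mem I hF (isUnit_iff_ne_zero.2 (by simpa using hF0) |>.map C)
  · have h := Nat.find_min hex ht
    push Not at h
    have : degPart I t = ⊥ := by
      rw [eq_bot_iff]
      intro x hx
      obtain ⟨hx, hx'⟩ := mem_degPart.1 hx
      by_contra h0
      exact h x hx h0 hx'
    rw [hilbSeries, PowerSeries.coeff_mk, this, finrank_bot, Nat.cast_zero]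

end Chain

theorem stmt13 {K : Type} [Field K] [Infinite K] {n : ℕ} (hn : 2 ≤ n)
    (I : Ideal (PR K n)) (hI : IsHomogIdeal I) (hIp : I ≠ ⊤) (hht : 2 ≤ idealHeight I)
    (hnolin : ∀ L ∈ I, L.IsHomogeneous 1 → L = 0) :
    ∃ (m : ℕ) (Js : ℕ → Ideal (PR K n)) (d : ℕ → ℕ), Js 0 = I ∧
      (∀ k < m, ∃ F L : PR K n, F ∈ Js k ∧ F ≠ 0 ∧ F.IsHomogeneous (d k) ∧
        L.IsHomogeneous 1 ∧ IsRegSeq F L ∧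
        Js (k + 1) = Ideal.span {L} * Js k + Ideal.span {F}) ∧
      (∀ k, k + 1 < m → d k < d (k + 1)) ∧
      NumACM (Js m) := by
  have hI0 : I ≠ ⊥ := by
    rintro rfl
    exact not_le_span_singleton_of_two_le_idealHeight hht (X_prime (i := 0)) bot_le
  obtain ⟨α, hα, ⟨F, hFI, hF0, hF⟩, hαI⟩ := exists_initial_form hI hI0 hIp
  obtain ⟨D, G, hGI, hG, hG0, hFG⟩ := exists_isHomogeneous_isRelPrime (by omega) hI hht hF0
  obtain ⟨Q, hQ⟩ := exists_hPolynomial hn hI hF0 hG0 hF hG hFI hGI hFG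
  have hf : IsHVector I Q.coeff := hQ
  obtain ⟨m, d, hd, hαd, hlt, hanti, hN⟩ := exists_linkVec_antitone hα
    (fun t ht => hf.eq_of_lt hαI ht)
    (fun t (ht : Q.natDegree + 1 ≤ t) => Polynomial.coeff_eq_zero_of_natDegree_lt ht)
  obtain ⟨L, hL, hL0, hFL⟩ := exists_linear_isRelPrime (by omega) hF0
  let Fs (k : ℕ) : PR K n := X 0 ^ (d k - α) * F
  have hFs (k : ℕ) : (Fs k).IsHomogeneous (d k) := by
    have := (isHomogeneous_X_pow (R := K) (0 : Fin (n + 1)) (d k - α)).mul hF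
    rwa [Nat.sub_add_cancel (hαd k)] at this
  have hFs0 (k : ℕ) : Fs k ≠ 0 := mul_ne_zero (pow_ne_zero _ (X_ne_zero 0)) hF0
  have hFs1 : Fs 0 ∈ I := I.mul_mem_left _ hFI
  have hdvd (k : ℕ) : Fs k ∣ Fs (k + 1) :=
    mul_dvd_mul_right (pow_dvd_pow _ (Nat.sub_le_sub_right (hd k.lt_succ_self).le _)) _
  refine ⟨m, linkIdeal L Fs I, d, rfl, fun k _ => ⟨Fs k, L, mem_linkIdeal L hFs1 hdvd k, hFs0 k,
    hFs k, hL, isRegSeq_of_isRelPrime (hFs0 k) (hFL _), rfl⟩, fun k _ => hd k.lt_succ_self, ?_⟩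
  exact numACM_of_isHVector (by omega)
    (hf.linkIdeal hI hL hL0 hFs hFs0 hFs1 hdvd (fun k => hFL _) m) (by omega) hlt hanti hN
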